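/- Consider an N-player game in which each player i's cost function has the separable pairwise form J_i(a) = α·S_i(a_i) + β·Σ_{k≠i} P_{i,k}(a_i, a_k), where α and β are real numbers, S_i : E_i → ℝ depends only on player i's own strategy, and the pairwise interaction functions satisfy the symmetry condition P_{j,k}(x, y) = P_{k,j}(y, x) for all players j ≠ k, all x ∈ E_j and all y ∈ E_k. Define F : (∀ i, E_i) → ℝ by F(a) = α·Σ_j S_j(a_j) + β·Σ_j Σ_{k<j} P_{j,k}(a_j, a_k), where the double sum ranges over pairs of players with k < j in the canonical linear order on Fin N. Then for every player i and every strategy profile a, the function x ↦ J_i(x, a_{−i}) − F(x, a_{−i}) from E_i to ℝ is constant, and consequently the partial derivatives with respect to player i's own strategy agree: for every x ∈ E_i, fderiv ℝ (fun x => J_i(x, a_{−i})) x = fderiv ℝ (fun x => F(x, a_{−i})) x. -/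

import Mathlib

theorem pair_sum_split {N : ℕ} (Q : Fin N → Fin N → ℝ)
    (hQ : ∀ j k, j ≠ k → Q j k = Q k j) (i : Fin N) :
    ∑ j, ∑ k ∈ Finset.univ.filter (fun k => k < j), Q j k
      = ∑ k ∈ Finset.univ.erase i, Q i k
        + ∑ j ∈ Finset.univ.erase i, ∑ k ∈ Finset.univ.erase i, if k < j then Q j k else 0 := by
  simp only [Finset.sum_filter]
  rw [← Finset.add_sum_erase _ _ (Finset.mem_univ i)]
  rw [← Finset.add_sum_erase _ _ (Finset.mem_univ i)]
  have h : ∀ j ∈ Finset.univ.erase i, (∑ k, if k < j then Q j k else 0)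
      = (if i < j then Q j i else 0)
        + ∑ k ∈ Finset.univ.erase i, if k < j then Q j k else 0 := by
    intro j _
    rw [← Finset.add_sum_erase _ _ (Finset.mem_univ i)]
  rw [Finset.sum_congr rfl h, Finset.sum_add_distrib, ← add_assoc]
  congr 1
  rw [if_neg (lt_irrefl i), zero_add, ← Finset.sum_add_distrib]
  refine Finset.sum_congr rfl fun k hk => ?_
  have hne : k ≠ i := Finset.ne_of_mem_erase hk
  rcases lt_or_gt_of_ne hne with h1 | h1
  · simp [h1, h1.not_gt]
  · simp [h1, h1.not_gt, hQ k i hne]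

/-- If each player's cost function has the separable pairwise form
`J i a = α * S i (a i) + β * ∑_{k ≠ i} P i k (a i) (a k)` with symmetric
pairwise interactions, and
`F a = α * ∑ j, S j (a j) + β * ∑ j, ∑_{k < j} P j k (a j) (a k)`,
then for every player `i` and profile `a`, the function
`x ↦ J i (x, a₋ᵢ) - F (x, a₋ᵢ)` is constant, and consequently the partial
(Fréchet) derivatives with respect to player `i`'s own strategy agree. -/
theorem separable_pairwise_costs_potential_partial_derivs
    {N : ℕ} {E : Fin N → Type*}
    [∀ i, NormedAddCommGroup (E i)] [∀ i, NormedSpace ℝ (E i)]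
    (α β : ℝ)
    (S : ∀ i : Fin N, E i → ℝ)
    (P : ∀ j k : Fin N, E j → E k → ℝ)
    (hsym : ∀ j k : Fin N, j ≠ k → ∀ (x : E j) (y : E k), P j k x y = P k j y x)
    (J : Fin N → (∀ i, E i) → ℝ)
    (hJ : ∀ (i : Fin N) (a : ∀ i, E i),
      J i a = α * S i (a i) + β * ∑ k ∈ Finset.univ.erase i, P i k (a i) (a k))
    (F : (∀ i, E i) → ℝ)
    (hF : ∀ a : ∀ i, E i,
      F a = α * ∑ j, S j (a j)
        + β * ∑ j, ∑ k ∈ Finset.univ.filter (fun k => k < j), P j k (a j) (a k)) :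
    ∀ (i : Fin N) (a : ∀ i, E i),
      (∃ r : ℝ, ∀ x : E i,
        J i (Function.update a i x) - F (Function.update a i x) = r) ∧
      (∀ x : E i,
        fderiv ℝ (fun y : E i => J i (Function.update a i y)) x
          = fderiv ℝ (fun y : E i => F (Function.update a i y)) x) := by
  intro i a
  have key : ∀ x : E i, J i (Function.update a i x) - F (Function.update a i x)
      = -(α * ∑ j ∈ Finset.univ.erase i, S j (a j)
        + β * ∑ j ∈ Finset.univ.erase i, ∑ k ∈ Finset.univ.erase i,
          if k < j then P j k (a j) (a k) else 0) := by
    intro x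
    have h1 : ∑ j ∈ Finset.univ.erase i, S j (a j)
        = ∑ j ∈ Finset.univ.erase i, S j (Function.update a i x j) := by
      refine Finset.sum_congr rfl fun j hj => ?_
      rw [Function.update_of_ne (Finset.ne_of_mem_erase hj)]
    have h2 : (∑ j ∈ Finset.univ.erase i, ∑ k ∈ Finset.univ.erase i,
          if k < j then P j k (a j) (a k) else 0)
        = ∑ j ∈ Finset.univ.erase i, ∑ k ∈ Finset.univ.erase i,
          if k < j then P j k (Function.update a i x j) (Function.update a i x k) else 0 := by
      refine Finset.sum_congr rfl fun j hj => Finset.sum_congr rfl fun k hk => ?_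
      rw [Function.update_of_ne (Finset.ne_of_mem_erase hj),
        Function.update_of_ne (Finset.ne_of_mem_erase hk)]
    rw [h1, h2]
    generalize Function.update a i x = b
    rw [hJ, hF, pair_sum_split (fun j k => P j k (b j) (b k))
      (fun j k hjk => hsym j k hjk _ _) i,
      ← Finset.add_sum_erase _ (fun j => S j (b j)) (Finset.mem_univ i)]
    ring
  refine ⟨⟨_, key⟩, fun x => ?_⟩
  have hfun : (fun y : E i => J i (Function.update a i y))
      = fun y : E i => F (Function.update a i y)
        + -(α * ∑ j ∈ Finset.univ.erase i, S j (a j)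
        + β * ∑ j ∈ Finset.univ.erase i, ∑ k ∈ Finset.univ.erase i,
          if k < j then P j k (a j) (a k) else 0) := by
    funext y
    rw [← key y]
    ring
  rw [hfun, fderiv_add_const]
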